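/- Let a and b be effects on a complex Hilbert space H. Then a and b are partially ortho-coexistent if and only if there exist effects a₁, a₂ such that a = a₁ + a₂, a₁ ≤ a ⩕ b and a₂ ≤ I - b. -/

import Mathlib

variable {H : Type*} [NormedAddCommGroup H] [InnerProductSpace ℂ H] [CompleteSpace H]

/-- The absolute value of a bounded operator. -/
noncomputable def oabs (u : H →L[ℂ] H) : H →L[ℂ] H := CFC.sqrt (star u * u)

/-- A Hilbert space effect: between 0 and I in the Loewner order. -/
def IsEffect (a : H →L[ℂ] H) : Prop := 0 ≤ a ∧ a ≤ 1

/-- The operation dotWedge. -/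
noncomputable def dotWedge (a b : H →L[ℂ] H) : H →L[ℂ] H :=
  ((1:ℂ)/2) • (a + b - oabs (a - b))

/-- The operation dotVee. -/
noncomputable def dotVee (a b : H →L[ℂ] H) : H →L[ℂ] H :=
  ((1:ℂ)/2) • (a + b + oabs (a - b))

/-- Effects a, b are partially ortho-coexistent. -/
def PartiallyOrthoCoexistent (a b : H →L[ℂ] H) : Prop :=
  ∃ x y z : H →L[ℂ] H, IsEffect x ∧ IsEffect y ∧ IsEffect z ∧
    a = x + y ∧ b = x + z ∧ IsEffect (x + y + z) ∧ y * z = 0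

theorem oabs_eq_posPart_add_negPart (u : H →L[ℂ] H) (hu : IsSelfAdjoint u) :
    oabs u = u⁺ + u⁻ :=
  (CFC.posPart_add_negPart u hu).symm

theorem oabs_sub_of_mul_eq_zero {y z : H →L[ℂ] H} (hy : 0 ≤ y) (hz : 0 ≤ z) (hyz : y * z = 0) :
    oabs (y - z) = y + z := by
  have hys : star y = y := (IsSelfAdjoint.of_nonneg hy).star_eq
  have hzs : star z = z := (IsSelfAdjoint.of_nonneg hz).star_eq
  have hzy : z * y = 0 := by
    simpa [hys, hzs] using congrArg star hyz
  refine CFC.sqrt_unique ?_ (add_nonneg hy hz)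
  simp [mul_add, add_mul, mul_sub, sub_mul, hys, hzs, hyz, hzy]

theorem dotWedge_eq_of_oabs_eq {a b x y z : H →L[ℂ] H} (ha : a = x + y) (hb : b = x + z)
    (h : oabs (a - b) = y + z) : dotWedge a b = x := by
  have h' : a + b - (y + z) = (2 : ℂ) • x := by
    rw [ha, hb, two_smul]; abel
  rw [dotWedge, h, h', smul_smul]
  norm_num

theorem partiallyOrthoCoexistent_iff_decomp_left (a b : H →L[ℂ] H)
    (ha : IsEffect a) (hb : IsEffect b) :
    PartiallyOrthoCoexistent a b ↔
      ∃ a₁ a₂ : H →L[ℂ] H, IsEffect a₁ ∧ IsEffect a₂ ∧ a = a₁ + a₂ ∧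
        a₁ ≤ dotWedge a b ∧ a₂ ≤ 1 - b := by
  constructor
  · rintro ⟨x, y, z, hx, hy, hz, hax, hbx, hs, hyz⟩
    have hab : a - b = y - z := by rw [hax, hbx]; abel
    have hw : dotWedge a b = x := dotWedge_eq_of_oabs_eq hax hbx
      (hab ▸ oabs_sub_of_mul_eq_zero hy.1 hz.1 hyz)
    refine ⟨x, y, hx, hy, hax, hw.ge, ?_⟩
    rw [le_sub_iff_add_le, hbx]
    convert hs.2 using 1
    abel
  · rintro ⟨a₁, a₂, h₁, h₂, haa, hw, h₂b⟩
    have hu : IsSelfAdjoint (a - b) :=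
      (IsSelfAdjoint.of_nonneg ha.1).sub (IsSelfAdjoint.of_nonneg hb.1)
    have hp : 0 ≤ (a - b)⁺ := CFC.posPart_nonneg _
    have hn : 0 ≤ (a - b)⁻ := CFC.negPart_nonneg _
    have hpn : (a - b)⁺ - (a - b)⁻ = a - b := CFC.posPart_sub_negPart _ hu
    have hax : a = (a - (a - b)⁺) + (a - b)⁺ := by abel
    have hbx : b = (a - (a - b)⁺) + (a - b)⁻ := by
      rw [sub_add, hpn]; abel
    rw [dotWedge_eq_of_oabs_eq hax hbx (oabs_eq_posPart_add_negPart _ hu)] at hw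
    have hm : (a - b)⁺ * (a - b)⁻ = 0 := CFC.posPart_mul_negPart _
    generalize (a - b)⁺ = y at *
    generalize (a - b)⁻ = z at *
    have hx : 0 ≤ a - y := h₁.1.trans hw
    have hs : a - y + y + z ≤ 1 := by
      have hya : y ≤ a₂ := by
        have := sub_le_sub_left hw a
        rwa [sub_sub_cancel, haa, add_sub_cancel_left] at this
      calc a - y + y + z = y + b := by rw [hbx]; abel
        _ ≤ a₂ + b := by gcongr
        _ ≤ 1 := le_sub_iff_add_le.mp h₂b
    refine ⟨a - y, y, z, ⟨hx, ?_⟩, ⟨hp, ?_⟩, ⟨hn, ?_⟩, hax, hbx, ⟨?_, hs⟩, hm⟩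
    · exact (sub_le_self a hp).trans ha.2
    · exact (sub_nonneg.mp hx).trans ha.2
    · exact (hbx ▸ le_add_of_nonneg_left hx : z ≤ b).trans hb.2
    · exact add_nonneg (add_nonneg hx hp) hn
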